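/- arXiv:1705.04611 — 2 statements merged into one kernel-verified Lean document; each statement's English description precedes it below -/
import Mathlib

section
/- Let n ≥ 1. Let A and A′ be finite antichains in the power set of Fin n ordered by inclusion (no two distinct members of A are comparable under ⊆, and likewise for A′), and let l : A → ℕ and l′ : A′ → ℕ be functions taking values ≥ 1. Then the projections ⊞_{S∈A} ⊞^{l(S)} Q_S and ⊞_{S∈A′} ⊞^{l′(S)} Q_S over the Toeplitz algebra T_n are equivalent if and only if A = A′ and l = l′. -/
noncomputable section

/-- `H n` is the Hilbert space `ℓ²(ℕ^n)`. -/
abbrev Hn (n : ℕ) : Type := lp (fun _ : (Fin n → ℕ) => ℂ) 2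

/-- the standard basis vector `δ_z`. -/
def delta {n : ℕ} (z : Fin n → ℕ) : Hn n := lp.single 2 z 1

/-- `T` is the `i`-th coordinate shift: `T δ_z = δ_{z + e_i}`. -/
def IsShift {n : ℕ} (i : Fin n) (T : Hn n →L[ℂ] Hn n) : Prop :=
  ∀ z : Fin n → ℕ, T (delta z) = delta (Function.update z i (z i + 1))

/-- The Toeplitz algebra `T_n`: the smallest norm-closed star-subalgebra of `B(H_n)`
containing the coordinate shifts. -/
def Toeplitz (n : ℕ) : StarSubalgebra ℂ (Hn n →L[ℂ] Hn n) :=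
  (StarAlgebra.adjoin ℂ {T : Hn n →L[ℂ] Hn n | ∃ i : Fin n, IsShift i T}).topologicalClosure

open scoped Classical in
/-- `Q` is the orthogonal projection onto the closed span of `{δ_z : z_i = 0 for all i ∉ S}`,
characterized by its action on the orthonormal basis. -/
def IsQProj {n : ℕ} (S : Finset (Fin n)) (Q : Hn n →L[ℂ] Hn n) : Prop :=
  ∀ z : Fin n → ℕ, Q (delta z) = if ∀ i ∉ S, z i = 0 then delta z else 0

/-- Padding a matrix by zeros into an `N × N` matrix along an embedding `f`. -/
def padMat {R : Type*} [Semiring R] {ι : Type*} [Fintype ι] {N : ℕ}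
    (f : ι ↪ Fin N) (P : Matrix ι ι R) : Matrix (Fin N) (Fin N) R :=
  fun i j => ∑ a : ι, ∑ b : ι, if f a = i ∧ f b = j then P a b else 0

/-- Equivalence of (idempotent) matrices over a ring `R`: after enlarging by zero diagonal blocks
to a common size `N`, they are conjugate by an invertible `N × N` matrix. -/
def IdemEquiv {R : Type*} [Ring R] {ι κ : Type*} [Fintype ι] [Fintype κ]
    (P : Matrix ι ι R) (Q : Matrix κ κ R) : Prop :=
  ∃ (N : ℕ) (f : ι ↪ Fin N) (g : κ ↪ Fin N) (U : (Matrix (Fin N) (Fin N) R)ˣ),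
    U.val * padMat f P * (U⁻¹).val = padMat g Q

/-- The block-diagonal projection `⊞_{S ∈ A} ⊞^{l(S)} Q_S`, as a diagonal matrix indexed by
`Σ S : A, Fin (l S)`. -/
def antichainMat {n : ℕ} (A : Finset (Finset (Fin n))) (l : Finset (Fin n) → ℕ)
    (q : Finset (Fin n) → ↥(Toeplitz n)) :
    Matrix ((S : {x // x ∈ A}) × Fin (l S.1)) ((S : {x // x ∈ A}) × Fin (l S.1)) ↥(Toeplitz n) :=
  Matrix.diagonal fun p => q p.1.1

section AsymptoticIntertwiners

open Filter Topology

/-- For uniformly Lipschitz maps, the set of points where they converge to zero is closed. -/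
theorem isClosed_setOf_tendsto_zero {X H : Type*} [NormedAddCommGroup H]
    [PseudoMetricSpace X] {f : ℕ → X → H} {C : ℝ}
    (hf : ∀ k x y, ‖f k x - f k y‖ ≤ C * dist x y) :
    IsClosed {x | Tendsto (fun k => f k x) atTop (𝓝 0)} := by
  have h : UniformEquicontinuous f :=
    LipschitzWith.uniformEquicontinuous f C.toNNReal fun k =>
      LipschitzWith.of_dist_le_mul fun x y => by
        rw [dist_eq_norm]
        exact (hf k x y).trans
          (mul_le_mul_of_nonneg_right (Real.le_coe_toNNReal C) dist_nonneg)
  exact h.equicontinuous.isClosed_setOfPred_tendsto (l := atTop) (continuous_const (y := (0 : H)))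

variable {G H : Type*} [NormedAddCommGroup G] [NormedSpace ℂ G]
  [NormedAddCommGroup H] [NormedSpace ℂ H]

/-- The pairs `(T, R)` such that `T V_k - V_k R` converges strongly to zero. -/
def asymptoticIntertwiners (V : ℕ → G →ₗᵢ[ℂ] H) : Subalgebra ℂ ((H →L[ℂ] H) × (G →L[ℂ] G)) where
  carrier := {p | ∀ x, Tendsto (fun k => p.1 (V k x) - V k (p.2 x)) atTop (𝓝 0)}
  mul_mem' := by
    intro p q hp hq x
    have h₁ := hp (q.2 x)
    have h₂ := (p.1.continuous.tendsto 0).comp (hq x)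
    rw [map_zero] at h₂
    simpa using h₂.add h₁
  add_mem' := by
    intro p q hp hq x
    have h := (hp x).add (hq x)
    rw [add_zero] at h
    refine h.congr fun k => ?_
    simp only [Prod.fst_add, Prod.snd_add, add_apply, map_add]
    abel
  algebraMap_mem' := by
    intro c x
    simp [Algebra.algebraMap_eq_smul_one]

theorem mem_asymptoticIntertwiners {V : ℕ → G →ₗᵢ[ℂ] H} {p : (H →L[ℂ] H) × (G →L[ℂ] G)} :
    p ∈ asymptoticIntertwiners V ↔
      ∀ x, Tendsto (fun k => p.1 (V k x) - V k (p.2 x)) atTop (𝓝 0) := Iff.rfl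

theorem norm_snd_le_of_mem_asymptoticIntertwiners {V : ℕ → G →ₗᵢ[ℂ] H}
    {p : (H →L[ℂ] H) × (G →L[ℂ] G)} (hp : p ∈ asymptoticIntertwiners V) : ‖p.2‖ ≤ ‖p.1‖ := by
  refine ContinuousLinearMap.opNorm_le_bound _ (norm_nonneg _) fun x => ?_
  have h : Tendsto (fun k => ‖p.1‖ * ‖x‖ + ‖p.1 (V k x) - V k (p.2 x)‖) atTop
      (𝓝 (‖p.1‖ * ‖x‖ + 0)) := tendsto_const_nhds.add (tendsto_zero_iff_norm_tendsto_zero.1 (hp x))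
  rw [add_zero] at h
  refine ge_of_tendsto' h fun k => ?_
  calc ‖p.2 x‖ = ‖p.1 (V k x) - (p.1 (V k x) - V k (p.2 x))‖ := by
        rw [sub_sub_cancel, LinearIsometry.norm_map]
    _ ≤ ‖p.1 (V k x)‖ + ‖p.1 (V k x) - V k (p.2 x)‖ := norm_sub_le _ _
    _ ≤ _ := by
      gcongr
      simpa using p.1.le_opNorm (V k x)

theorem isClosed_asymptoticIntertwiners (V : ℕ → G →ₗᵢ[ℂ] H) :
    IsClosed (asymptoticIntertwiners V : Set ((H →L[ℂ] H) × (G →L[ℂ] G))) := by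
  have h : (asymptoticIntertwiners V : Set ((H →L[ℂ] H) × (G →L[ℂ] G))) =
      ⋂ x, {p | Tendsto (fun k => p.1 (V k x) - V k (p.2 x)) atTop (𝓝 0)} := by
    ext p
    simp [mem_asymptoticIntertwiners]
  rw [h]
  refine isClosed_iInter fun x => isClosed_setOf_tendsto_zero
    (f := fun k (p : (H →L[ℂ] H) × (G →L[ℂ] G)) => p.1 (V k x) - V k (p.2 x))
    (C := 2 * ‖x‖) fun k p q => ?_
  calc ‖p.1 (V k x) - V k (p.2 x) - (q.1 (V k x) - V k (q.2 x))‖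
      = ‖(p.1 - q.1) (V k x) - V k ((p.2 - q.2) x)‖ := by
        congr 1
        simp only [sub_apply, map_sub]
        abel
    _ ≤ ‖(p.1 - q.1) (V k x)‖ + ‖V k ((p.2 - q.2) x)‖ := norm_sub_le _ _
    _ ≤ ‖p.1 - q.1‖ * ‖x‖ + ‖p.2 - q.2‖ * ‖x‖ := by
      gcongr
      · simpa using (p.1 - q.1).le_opNorm (V k x)
      · rw [LinearIsometry.norm_map]
        exact (p.2 - q.2).le_opNorm x
    _ ≤ dist p q * ‖x‖ + dist p q * ‖x‖ := by
      rw [dist_eq_norm]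
      gcongr
      · exact norm_fst_le (p - q)
      · exact norm_snd_le (p - q)
    _ = 2 * ‖x‖ * dist p q := by ring

/-- The operators having an asymptotic compression form a norm-closed subalgebra. -/
theorem isClosed_map_fst_asymptoticIntertwiners [CompleteSpace G] [CompleteSpace H]
    (V : ℕ → G →ₗᵢ[ℂ] H) :
    IsClosed (((asymptoticIntertwiners V).map (AlgHom.fst ℂ (H →L[ℂ] H) (G →L[ℂ] G)) :
      Subalgebra ℂ (H →L[ℂ] H)) : Set (H →L[ℂ] H)) := by
  have hc : CompleteSpace (asymptoticIntertwiners V) :=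
    (isClosed_asymptoticIntertwiners V).completeSpace_coe
  have hiso : Isometry fun p : asymptoticIntertwiners V => p.1.1 := by
    refine Isometry.of_dist_eq fun p q => ?_
    rw [Subtype.dist_eq, dist_eq_norm, dist_eq_norm, Prod.norm_def, Prod.fst_sub]
    exact (max_eq_left (norm_snd_le_of_mem_asymptoticIntertwiners ((asymptoticIntertwiners V).sub_mem p.2 q.2))).symm
  have h : (((asymptoticIntertwiners V).map (AlgHom.fst ℂ (H →L[ℂ] H) (G →L[ℂ] G)) :
      Subalgebra ℂ (H →L[ℂ] H)) : Set (H →L[ℂ] H)) =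
        Set.range fun p : asymptoticIntertwiners V => p.1.1 := by
    ext T
    simp
  rw [h]
  exact hiso.isClosedEmbedding.isClosed_range

/-- The asymptotic compression along `V`, as a ring homomorphism on a subalgebra all of whose
elements admit one. -/
theorem exists_asymptotic_compression {B : Type*} [Ring B] (π : B →+* (H →L[ℂ] H))
    (V : ℕ → G →ₗᵢ[ℂ] H) (h : ∀ T : B, ∃ R, (π T, R) ∈ asymptoticIntertwiners V) :
    ∃ ρ : B →+* (G →L[ℂ] G), ∀ T, (π T, ρ T) ∈ asymptoticIntertwiners V := by
  have huniq : ∀ {T : H →L[ℂ] H} {R R' : G →L[ℂ] G}, (T, R) ∈ asymptoticIntertwiners V →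
      (T, R') ∈ asymptoticIntertwiners V → R = R' := by
    intro T R R' hR hR'
    have := norm_snd_le_of_mem_asymptoticIntertwiners ((asymptoticIntertwiners V).sub_mem hR hR')
    rwa [Prod.fst_sub, Prod.snd_sub, sub_self, norm_zero, norm_le_zero_iff, sub_eq_zero] at this
  choose ρ hρ using h
  refine ⟨{ toFun := ρ, map_one' := ?_, map_mul' := ?_, map_zero' := ?_, map_add' := ?_ }, hρ⟩
  · refine huniq (hρ 1) ?_
    rw [map_one]
    exact (asymptoticIntertwiners V).one_mem
  · intro S T
    refine huniq (hρ _) ?_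
    rw [map_mul]
    have h := (asymptoticIntertwiners V).mul_mem (hρ S) (hρ T)
    rwa [Prod.mk_mul_mk] at h
  · refine huniq (hρ 0) ?_
    rw [map_zero]
    exact (asymptoticIntertwiners V).zero_mem
  · intro S T
    refine huniq (hρ _) ?_
    rw [map_add]
    have h := (asymptoticIntertwiners V).add_mem (hρ S) (hρ T)
    rwa [Prod.mk_add_mk] at h

end AsymptoticIntertwiners

section SquareSummable

open Filter Topology

variable {J E : Type*} [NormedAddCommGroup E] [InnerProductSpace ℂ E]

theorem lp.single_eq_smul_single_one [DecidableEq J] (w : J) (a : ℂ) :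
    (lp.single 2 w a : lp (fun _ : J => ℂ) 2) = a • lp.single 2 w (1 : ℂ) := by
  rw [← lp.single_smul, smul_eq_mul, mul_one]

theorem lp.inner_single_one_left [DecidableEq J] (w : J) (x : lp (fun _ : J => ℂ) 2) :
    inner ℂ (lp.single 2 w (1 : ℂ)) x = x w := by
  rw [lp.inner_single_left]
  simp

theorem lp.orthonormal_single_one [DecidableEq J] :
    Orthonormal ℂ fun w : J => (lp.single 2 w (1 : ℂ) : lp (fun _ : J => ℂ) 2) := by
  rw [orthonormal_iff_ite]
  intro v w
  rw [lp.inner_single_one_left, lp.single_apply, Pi.single_apply]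

theorem lp.continuousLinearMap_ext_single_one [DecidableEq J]
    {A B : lp (fun _ : J => ℂ) 2 →L[ℂ] E}
    (h : ∀ w, A (lp.single 2 w 1) = B (lp.single 2 w 1)) : A = B := by
  refine lp.ext_continuousLinearMap (ENNReal.ofNat_ne_top (n := nat_lit 2)) fun w => ?_
  ext
  simpa using h w

/-- Uniformly bounded operators on `ℓ²` that tend to zero on the standard basis tend strongly
to zero. -/
theorem lp.tendsto_zero_of_tendsto_single_one [DecidableEq J]
    {A : ℕ → lp (fun _ : J => ℂ) 2 →L[ℂ] E} {C : ℝ} (hC : ∀ k, ‖A k‖ ≤ C)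
    (h : ∀ w, Tendsto (fun k => A k (lp.single 2 w 1)) atTop (𝓝 0))
    (x : lp (fun _ : J => ℂ) 2) : Tendsto (fun k => A k x) atTop (𝓝 0) := by
  have hclosed : IsClosed {x | Tendsto (fun k => A k x) atTop (𝓝 0)} :=
    isClosed_setOf_tendsto_zero (f := fun k x => A k x) (C := C) fun k x y => by
      rw [← map_sub, dist_eq_norm]
      exact (A k).le_of_opNorm_le (hC k) _
  refine hclosed.mem_of_tendsto
    (lp.hasSum_single (ENNReal.ofNat_ne_top (n := nat_lit 2)) x) (Eventually.of_forall fun s => ?_)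
  have hs : Tendsto (fun k => ∑ w ∈ s, x w • A k (lp.single 2 w 1)) atTop
      (𝓝 (∑ w ∈ s, x w • (0 : E))) := tendsto_finsetSum _ fun w _ => (h w).const_smul (x w)
  simp only [smul_zero, Finset.sum_const_zero] at hs
  refine hs.congr fun k => ?_
  rw [map_sum]
  refine Finset.sum_congr rfl fun w _ => ?_
  rw [lp.single_eq_smul_single_one w (x w), map_smul]

/-- The isometry from `ℓ²` sending the standard basis to a given orthonormal family. -/
def Orthonormal.l2Isometry [CompleteSpace E] {v : J → E} (hv : Orthonormal ℂ v) :
    lp (fun _ : J => ℂ) 2 →ₗᵢ[ℂ] E :=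
  hv.orthogonalFamily.linearIsometry

theorem Orthonormal.l2Isometry_single_one [CompleteSpace E] [DecidableEq J] {v : J → E}
    (hv : Orthonormal ℂ v) (w : J) : hv.l2Isometry (lp.single 2 w 1) = v w := by
  rw [Orthonormal.l2Isometry, OrthogonalFamily.linearIsometry_apply_single]
  simp

theorem mem_asymptoticIntertwiners_of_single_one [DecidableEq J]
    {V : ℕ → lp (fun _ : J => ℂ) 2 →ₗᵢ[ℂ] E} {T : E →L[ℂ] E}
    {R : lp (fun _ : J => ℂ) 2 →L[ℂ] lp (fun _ : J => ℂ) 2}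
    (h : ∀ w, Tendsto (fun k => T (V k (lp.single 2 w 1)) - V k (R (lp.single 2 w 1)))
      atTop (𝓝 0)) :
    (T, R) ∈ asymptoticIntertwiners V := by
  refine lp.tendsto_zero_of_tendsto_single_one (C := ‖T‖ + ‖R‖)
    (A := fun k => T ∘L (V k).toContinuousLinearMap - (V k).toContinuousLinearMap ∘L R)
    (fun k => ?_) h
  refine ContinuousLinearMap.opNorm_le_bound _ (by positivity) fun x => ?_
  calc ‖T (V k x) - V k (R x)‖ ≤ ‖T (V k x)‖ + ‖V k (R x)‖ := norm_sub_le _ _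
    _ ≤ ‖T‖ * ‖x‖ + ‖R‖ * ‖x‖ := by
      rw [LinearIsometry.norm_map]
      gcongr
      · simpa using T.le_opNorm (V k x)
      · exact R.le_opNorm x
    _ = _ := by ring

end SquareSummable

section Boxes

open Filter Topology

variable {n : ℕ}

/-- Raising the `i`-th coordinate of `z` by one. -/
def bump (i : Fin n) (z : Fin n → ℕ) : Fin n → ℕ := Function.update z i (z i + 1)

theorem bump_same (i : Fin n) (z : Fin n → ℕ) : bump i z i = z i + 1 := Function.update_self ..

theorem bump_of_ne {i j : Fin n} (h : j ≠ i) (z : Fin n → ℕ) : bump i z j = z j :=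
  Function.update_of_ne h ..

theorem bump_injective (i : Fin n) : Function.Injective (bump i) := by
  intro y z h
  ext j
  have hj := congrFun h j
  by_cases hji : j = i
  · subst hji
    simpa [bump_same] using hj
  · simpa [bump_of_ne hji] using hj

theorem exists_bump_eq {i : Fin n} {z : Fin n → ℕ} (h : z i ≠ 0) : ∃ y, bump i y = z := by
  refine ⟨Function.update z i (z i - 1), funext fun j => ?_⟩
  by_cases hji : j = i
  · subst hji
    rw [bump_same, Function.update_self]
    omega
  · rw [bump_of_ne hji, Function.update_of_ne hji]

theorem delta_inner (z : Fin n → ℕ) (x : Hn n) : inner ℂ (delta z) x = x z :=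
  lp.inner_single_one_left z x

theorem delta_apply (y z : Fin n → ℕ) : (delta y : Hn n) z = if z = y then 1 else 0 := by
  rw [delta, lp.single_apply, Pi.single_apply]

theorem inner_sum_delta (s t : Finset (Fin n → ℕ)) :
    inner ℂ (∑ z ∈ s, (delta z : Hn n)) (∑ z ∈ t, (delta z : Hn n)) = ((s ∩ t).card : ℂ) := by
  simp [delta_inner, delta_apply, Finset.sum_ite_mem, Finset.inter_comm]

theorem IsShift.apply_sum_delta {i : Fin n} {T : Hn n →L[ℂ] Hn n} (hT : IsShift i T)
    (s : Finset (Fin n → ℕ)) :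
    T (∑ z ∈ s, delta z) = ∑ z ∈ s.image (bump i), delta z := by
  rw [map_sum, Finset.sum_image fun _ _ _ _ h => bump_injective i h]
  exact Finset.sum_congr rfl fun z _ => hT z

theorem IsShift.star_mul_self {i : Fin n} {T : Hn n →L[ℂ] Hn n} (hT : IsShift i T) :
    star T * T = 1 := by
  refine lp.continuousLinearMap_ext_single_one fun z => ?_
  change star T (T (delta z)) = delta z
  ext y
  rw [← delta_inner, ContinuousLinearMap.star_eq_adjoint, ContinuousLinearMap.adjoint_inner_right,
    hT z, hT y, delta_inner, delta_apply, delta_apply]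
  exact if_congr (bump_injective i).eq_iff rfl rfl

theorem IsShift.star_apply_apply {i : Fin n} {T : Hn n →L[ℂ] Hn n} (hT : IsShift i T)
    (x : Hn n) : star T (T x) = x :=
  DFunLike.congr_fun hT.star_mul_self x

theorem IsShift.star_apply_delta_of_eq_zero {i : Fin n} {T : Hn n →L[ℂ] Hn n} (hT : IsShift i T)
    {z : Fin n → ℕ} (hz : z i = 0) : star T (delta z) = 0 := by
  ext y
  rw [← delta_inner, ContinuousLinearMap.star_eq_adjoint, ContinuousLinearMap.adjoint_inner_right,
    hT y, delta_inner, delta_apply, if_neg]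
  · rfl
  · intro h
    have := congrFun h i
    rw [Function.update_self] at this
    omega

/-- The points that agree with `w` off `S` and have coordinates in `[1, k + 1]` on `S`. -/
def box (S : Finset (Fin n)) (k : ℕ) (w : Fin n → ℕ) : Finset (Fin n → ℕ) :=
  Fintype.piFinset fun i => if i ∈ S then Finset.Icc 1 (k + 1) else {w i}

theorem mem_box {S : Finset (Fin n)} {k : ℕ} {w z : Fin n → ℕ} :
    z ∈ box S k w ↔ (∀ i ∈ S, 1 ≤ z i ∧ z i ≤ k + 1) ∧ ∀ i ∉ S, z i = w i := by
  rw [box, Fintype.mem_piFinset]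
  constructor
  · intro h
    refine ⟨fun i hi => ?_, fun i hi => ?_⟩
    · simpa [hi] using h i
    · simpa [hi] using h i
  · rintro ⟨h₁, h₂⟩ i
    by_cases hi : i ∈ S
    · simpa [hi] using h₁ i hi
    · simpa [hi] using h₂ i hi

theorem card_box (S : Finset (Fin n)) (k : ℕ) (w : Fin n → ℕ) :
    (box S k w).card = (k + 1) ^ S.card := by
  rw [box, Fintype.card_piFinset]
  simp [apply_ite Finset.card, Finset.prod_ite_mem]

theorem image_bump_box {S : Finset (Fin n)} {i : Fin n} (hi : i ∉ S) (k : ℕ) (w : Fin n → ℕ) :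
    (box S k w).image (bump i) = box S k (bump i w) := by
  have hne : ∀ j ∈ S, j ≠ i := fun j hj h => hi (h ▸ hj)
  ext z
  rw [Finset.mem_image]
  constructor
  · rintro ⟨y, hy, rfl⟩
    rw [mem_box] at hy ⊢
    refine ⟨fun j hj => ?_, fun j hj => ?_⟩
    · rw [bump_of_ne (hne j hj)]
      exact hy.1 j hj
    · by_cases hji : j = i
      · subst hji
        rw [bump_same, bump_same, hy.2 j hj]
      · rw [bump_of_ne hji, bump_of_ne hji, hy.2 j hj]
  · intro hz
    rw [mem_box] at hz
    have hzi := hz.2 i hi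
    rw [bump_same] at hzi
    obtain ⟨y, rfl⟩ := exists_bump_eq (i := i) (z := z) (by omega)
    refine ⟨y, mem_box.2 ⟨fun j hj => ?_, fun j hj => ?_⟩, rfl⟩
    · simpa only [bump_of_ne (hne j hj)] using hz.1 j hj
    · have := hz.2 j hj
      by_cases hji : j = i
      · subst hji
        simpa only [bump_same, Nat.add_right_cancel_iff] using this
      · simpa only [bump_of_ne hji] using this

theorem card_box_sdiff_image_bump_le {S : Finset (Fin n)} {i : Fin n} (hi : i ∈ S) (k : ℕ)
    (w : Fin n → ℕ) : (box S k w \ (box S k w).image (bump i)).card * (k + 1) ≤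
      (box S k w).card := by
  have hsub : box S k w \ (box S k w).image (bump i) ⊆
      box (S.erase i) k (Function.update w i 1) := by
    intro z hz
    obtain ⟨hz, hz'⟩ := Finset.mem_sdiff.1 hz
    have hzi : z i = 1 := by
      by_contra hne
      refine hz' (Finset.mem_image.2 ?_)
      rw [mem_box] at hz
      have hb := hz.1 i hi
      obtain ⟨y, rfl⟩ := exists_bump_eq (i := i) (z := z) (by omega)
      rw [bump_same] at hb hne
      refine ⟨y, mem_box.2 ⟨fun j hj => ?_, fun j hj => ?_⟩, rfl⟩
      · by_cases hji : j = i
        · subst hji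
          omega
        · simpa only [bump_of_ne hji] using hz.1 j hj
      · have hji : j ≠ i := fun h => hj (h ▸ hi)
        simpa only [bump_of_ne hji] using hz.2 j hj
    rw [mem_box] at hz ⊢
    refine ⟨fun j hj => hz.1 j (Finset.mem_of_mem_erase hj), fun j hj => ?_⟩
    by_cases hji : j = i
    · subst hji
      rw [hzi, Function.update_self]
    · rw [Function.update_of_ne hji]
      exact hz.2 j fun h => hj (Finset.mem_erase.2 ⟨hji, h⟩)
  have hS : S.card = (S.erase i).card + 1 := (Finset.card_erase_add_one hi).symm
  calc _ ≤ (box (S.erase i) k (Function.update w i 1)).card * (k + 1) :=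
        Nat.mul_le_mul_right _ (Finset.card_le_card hsub)
    _ = (box S k w).card := by rw [card_box, card_box, hS, pow_succ]

/-- The normalized indicator of a box. -/
def boxVector (S : Finset (Fin n)) (k : ℕ) (w : Fin n → ℕ) : Hn n :=
  (((√((k + 1 : ℝ) ^ S.card))⁻¹ : ℝ) : ℂ) • ∑ z ∈ box S k w, delta z

/-- The lattice points whose coordinates in `S` vanish. -/
abbrev Transverse (S : Finset (Fin n)) : Type := {w : Fin n → ℕ // ∀ i ∈ S, w i = 0}

theorem orthonormal_boxVector (S : Finset (Fin n)) (k : ℕ) :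
    Orthonormal ℂ fun w : Transverse S => boxVector S k w.1 := by
  rw [orthonormal_iff_ite]
  intro v w
  have hpos : (0 : ℝ) < (k + 1 : ℝ) ^ S.card := by positivity
  rw [boxVector, boxVector, inner_smul_left, inner_smul_right, inner_sum_delta, Complex.conj_ofReal]
  split_ifs with h
  · subst h
    rw [Finset.inter_self, card_box, ← mul_assoc, ← Complex.ofReal_mul, ← mul_inv,
      Real.mul_self_sqrt hpos.le]
    push_cast
    refine inv_mul_cancel₀ ?_
    exact_mod_cast hpos.ne'
  · have hdisj : box S k v.1 ∩ box S k w.1 = ∅ := by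
      refine Finset.eq_empty_of_forall_notMem fun z hz => h (Subtype.ext (funext fun i => ?_))
      obtain ⟨hv, hw⟩ := Finset.mem_inter.1 hz
      by_cases hi : i ∈ S
      · rw [v.2 i hi, w.2 i hi]
      · rw [← (mem_box.1 hv).2 i hi, ← (mem_box.1 hw).2 i hi]
    simp [hdisj]

theorem IsShift.apply_boxVector {S : Finset (Fin n)} {i : Fin n} (hi : i ∉ S)
    {T : Hn n →L[ℂ] Hn n} (hT : IsShift i T) (k : ℕ) (w : Fin n → ℕ) :
    T (boxVector S k w) = boxVector S k (bump i w) := by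
  rw [boxVector, map_smul, hT.apply_sum_delta, image_bump_box hi, boxVector]

theorem IsShift.star_apply_boxVector_of_eq_zero {S : Finset (Fin n)} {i : Fin n} (hi : i ∉ S)
    {T : Hn n →L[ℂ] Hn n} (hT : IsShift i T) (k : ℕ) {w : Fin n → ℕ} (hw : w i = 0) :
    star T (boxVector S k w) = 0 := by
  rw [boxVector, map_smul, map_sum, Finset.sum_eq_zero, smul_zero]
  intro z hz
  exact hT.star_apply_delta_of_eq_zero (((mem_box.1 hz).2 i hi).trans hw)

theorem norm_sum_delta (s : Finset (Fin n → ℕ)) : ‖∑ z ∈ s, (delta z : Hn n)‖ = √s.card := by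
  rw [@norm_eq_sqrt_re_inner ℂ, inner_sum_delta, Finset.inter_self]
  simp

theorem IsShift.norm_apply_boxVector_sub_le {S : Finset (Fin n)} {i : Fin n} (hi : i ∈ S)
    {T : Hn n →L[ℂ] Hn n} (hT : IsShift i T) (k : ℕ) (w : Fin n → ℕ) :
    ‖T (boxVector S k w) - boxVector S k w‖ ≤ 2 * √(1 / ((k : ℝ) + 1)) := by
  set s := box S k w with hs
  set t := s.image (bump i) with ht
  have hcard : (t \ s).card = (s \ t).card := by
    have htc : t.card = s.card := Finset.card_image_of_injective _ (bump_injective i)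
    have h₁ := Finset.card_sdiff_add_card_inter t s
    have h₂ := Finset.card_sdiff_add_card_inter s t
    rw [Finset.inter_comm] at h₂
    omega
  have hle : ((s \ t).card : ℝ) * (k + 1) ≤ (k + 1 : ℝ) ^ S.card := by
    have h := card_box_sdiff_image_bump_le hi k w
    rw [← hs, ← ht, hs, card_box, ← hs] at h
    exact_mod_cast h
  have hpos : (0 : ℝ) < (k + 1 : ℝ) ^ S.card := by positivity
  have hk : (0 : ℝ) < k + 1 := by positivity
  have hsum : ∑ z ∈ t, (delta z : Hn n) - ∑ z ∈ s, delta z =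
      ∑ z ∈ t \ s, delta z - ∑ z ∈ s \ t, delta z := by
    rw [← Finset.sum_inter_add_sum_sdiff t s, ← Finset.sum_inter_add_sum_sdiff s t,
      Finset.inter_comm s t]
    abel
  rw [boxVector, map_smul, hT.apply_sum_delta, ← smul_sub, hsum, norm_smul, Complex.norm_real,
    Real.norm_of_nonneg (by positivity)]
  calc (√((k + 1 : ℝ) ^ S.card))⁻¹ * ‖∑ z ∈ t \ s, (delta z : Hn n) - ∑ z ∈ s \ t, delta z‖
      ≤ (√((k + 1 : ℝ) ^ S.card))⁻¹ * (√(s \ t).card + √(s \ t).card) := by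
        gcongr
        refine (norm_sub_le _ _).trans_eq ?_
        rw [norm_sum_delta, norm_sum_delta, hcard]
    _ = 2 * √((s \ t).card / (k + 1 : ℝ) ^ S.card) := by
        rw [Real.sqrt_div (Nat.cast_nonneg _)]
        ring
    _ ≤ 2 * √(1 / ((k : ℝ) + 1)) := by
        gcongr 2 * √?_
        rw [div_le_div_iff₀ hpos hk, one_mul]
        exact hle

theorem IsShift.tendsto_apply_boxVector_sub {S : Finset (Fin n)} {i : Fin n} (hi : i ∈ S)
    {T : Hn n →L[ℂ] Hn n} (hT : IsShift i T) (w : Fin n → ℕ) :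
    Tendsto (fun k => T (boxVector S k w) - boxVector S k w) atTop (𝓝 0) := by
  refine squeeze_zero_norm (hT.norm_apply_boxVector_sub_le hi · w) ?_
  have h := (tendsto_one_div_add_atTop_nhds_zero_nat (𝕜 := ℝ)).sqrt.const_mul 2
  simpa using h

theorem IsQProj.apply_boxVector {S S' : Finset (Fin n)} {Q : Hn n →L[ℂ] Hn n}
    (hQ : IsQProj S' Q) (k : ℕ) (w : Fin n → ℕ) [Decidable (S ⊆ S' ∧ ∀ i ∉ S', w i = 0)] :
    Q (boxVector S k w) =
      if S ⊆ S' ∧ ∀ i ∉ S', w i = 0 then boxVector S k w else 0 := by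
  classical
  rw [boxVector, map_smul, map_sum]
  split_ifs with h
  · congr 1
    refine Finset.sum_congr rfl fun z hz => ?_
    rw [hQ z, if_pos]
    intro i hi
    rw [(mem_box.1 hz).2 i fun hiS => hi (h.1 hiS), h.2 i hi]
  · rw [Finset.sum_eq_zero, smul_zero]
    intro z hz
    rw [hQ z, if_neg]
    intro hz0
    have hsub : S ⊆ S' := by
      intro i hi
      by_contra hi'
      have := (mem_box.1 hz).1 i hi
      have := hz0 i hi'
      omega
    exact h ⟨hsub, fun i hi => by rw [← (mem_box.1 hz).2 i fun hiS => hi (hsub hiS), hz0 i hi]⟩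

end Boxes

section Compression

open Filter Topology

variable {n : ℕ} (S : Finset (Fin n))

/-- The isometry sending `δ_w` to the normalized indicator of the box over `w`. -/
def boxIsometry (k : ℕ) : lp (fun _ : Transverse S => ℂ) 2 →ₗᵢ[ℂ] Hn n :=
  (orthonormal_boxVector S k).l2Isometry

theorem boxIsometry_single_one (k : ℕ) (w : Transverse S) :
    boxIsometry S k (lp.single 2 w 1) = boxVector S k w.1 :=
  Orthonormal.l2Isometry_single_one _ w

variable {S}

/-- Raising a coordinate not in `S` by one. -/
def Transverse.bump {i : Fin n} (hi : i ∉ S) (w : Transverse S) : Transverse S :=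
  ⟨_root_.bump i w.1, fun j hj => by rw [bump_of_ne (fun h => hi (h ▸ hj) : j ≠ i), w.2 j hj]⟩

theorem Transverse.bump_injective {i : Fin n} (hi : i ∉ S) :
    Function.Injective (Transverse.bump hi) := fun _ _ h =>
  Subtype.ext (_root_.bump_injective i (congrArg Subtype.val h))

theorem Transverse.exists_bump_eq {i : Fin n} (hi : i ∉ S) {w : Transverse S} (hw : w.1 i ≠ 0) :
    ∃ v, Transverse.bump hi v = w := by
  obtain ⟨y, hy⟩ := _root_.exists_bump_eq hw
  refine ⟨⟨y, fun j hj => ?_⟩, Subtype.ext hy⟩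
  rw [← w.2 j hj, ← hy, bump_of_ne (fun h => hi (h ▸ hj) : j ≠ i)]

/-- The coordinate shift on `ℓ²` of the transverse lattice points. -/
def transverseShift {i : Fin n} (hi : i ∉ S) :
    lp (fun _ : Transverse S => ℂ) 2 →ₗᵢ[ℂ] lp (fun _ : Transverse S => ℂ) 2 :=
  (lp.orthonormal_single_one.comp _ (Transverse.bump_injective hi)).l2Isometry

theorem transverseShift_single_one {i : Fin n} (hi : i ∉ S) (w : Transverse S) :
    transverseShift hi (lp.single 2 w 1) = lp.single 2 (Transverse.bump hi w) 1 :=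
  Orthonormal.l2Isometry_single_one _ w

theorem star_transverseShift_apply {i : Fin n} (hi : i ∉ S)
    (x : lp (fun _ : Transverse S => ℂ) 2) :
    star (transverseShift hi).toContinuousLinearMap (transverseShift hi x) = x := by
  refine ext_inner_left ℂ fun y => ?_
  rw [ContinuousLinearMap.star_eq_adjoint, ContinuousLinearMap.adjoint_inner_right]
  exact (transverseShift hi).inner_map_map y x

theorem star_transverseShift_single_one {i : Fin n} (hi : i ∉ S) {w : Transverse S}
    (hw : w.1 i = 0) :
    star (transverseShift hi).toContinuousLinearMap (lp.single 2 w 1) = 0 := by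
  ext y
  rw [← lp.inner_single_one_left, ContinuousLinearMap.star_eq_adjoint,
    ContinuousLinearMap.adjoint_inner_right, LinearIsometry.coe_toContinuousLinearMap,
    transverseShift_single_one, lp.inner_single_one_left, lp.single_apply, Pi.single_apply, if_neg]
  · rfl
  · intro h
    have hb : bump i y.1 i = w.1 i := congrFun (congrArg Subtype.val h) i
    rw [hw, bump_same] at hb
    omega

theorem IsShift.exists_mem_asymptoticIntertwiners {i : Fin n} {T : Hn n →L[ℂ] Hn n}
    (hT : IsShift i T) : ∃ R, (T, R) ∈ asymptoticIntertwiners (boxIsometry S) := by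
  by_cases hi : i ∈ S
  · refine ⟨1, mem_asymptoticIntertwiners_of_single_one fun w => ?_⟩
    simp only [one_apply_eq_self, boxIsometry_single_one]
    exact hT.tendsto_apply_boxVector_sub hi w.1
  · refine ⟨(transverseShift hi).toContinuousLinearMap,
      mem_asymptoticIntertwiners_of_single_one fun w => ?_⟩
    simp only [LinearIsometry.coe_toContinuousLinearMap, transverseShift_single_one,
      boxIsometry_single_one, hT.apply_boxVector hi]
    simp [Transverse.bump]

theorem IsShift.exists_star_mem_asymptoticIntertwiners {i : Fin n} {T : Hn n →L[ℂ] Hn n}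
    (hT : IsShift i T) : ∃ R, (star T, R) ∈ asymptoticIntertwiners (boxIsometry S) := by
  by_cases hi : i ∈ S
  · refine ⟨1, mem_asymptoticIntertwiners_of_single_one fun w => ?_⟩
    have h := (((star T).continuous.tendsto 0).comp (hT.tendsto_apply_boxVector_sub hi w.1)).neg
    rw [map_zero, neg_zero] at h
    refine h.congr fun k => ?_
    simp only [Function.comp_apply, one_apply_eq_self, boxIsometry_single_one, map_sub,
      hT.star_apply_apply, neg_sub]
  · refine ⟨star (transverseShift hi).toContinuousLinearMap,
      mem_asymptoticIntertwiners_of_single_one fun w => ?_⟩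
    refine tendsto_const_nhds.congr fun k => ?_
    by_cases hw : w.1 i = 0
    · rw [star_transverseShift_single_one hi hw, boxIsometry_single_one,
        hT.star_apply_boxVector_of_eq_zero hi k hw, map_zero, sub_zero]
    · obtain ⟨v, rfl⟩ := Transverse.exists_bump_eq hi hw
      rw [← transverseShift_single_one, star_transverseShift_apply, transverseShift_single_one,
        boxIsometry_single_one, boxIsometry_single_one, Transverse.bump,
        ← hT.apply_boxVector hi, hT.star_apply_apply, sub_self]

variable (S)

theorem exists_mem_asymptoticIntertwiners_of_mem_toeplitz {T : Hn n →L[ℂ] Hn n}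
    (hT : T ∈ Toeplitz n) : ∃ R, (T, R) ∈ asymptoticIntertwiners (boxIsometry S) := by
  have hle : (Toeplitz n).toSubalgebra ≤ (asymptoticIntertwiners (boxIsometry S)).map
      (AlgHom.fst ℂ (Hn n →L[ℂ] Hn n) _) := by
    rw [Toeplitz, StarSubalgebra.topologicalClosure_toSubalgebra_comm]
    refine Subalgebra.topologicalClosure_minimal ?_
      (isClosed_map_fst_asymptoticIntertwiners (boxIsometry S))
    rw [StarAlgebra.adjoin_toSubalgebra, Algebra.adjoin_le_iff]
    rintro T (⟨i, hT⟩ | ⟨i, hT⟩)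
    · obtain ⟨R, hR⟩ := hT.exists_mem_asymptoticIntertwiners (S := S)
      exact ⟨_, hR, rfl⟩
    · obtain ⟨R, hR⟩ := hT.exists_star_mem_asymptoticIntertwiners (S := S)
      rw [star_star] at hR
      exact ⟨_, hR, rfl⟩
  obtain ⟨p, hp, rfl⟩ := hle hT
  exact ⟨p.2, hp⟩

/-- Sending the coordinates in `S` to infinity and evaluating the symbol at `1` is a ring
homomorphism on the Toeplitz algebra; it is specified here by its values on the projections `Q`. -/
theorem exists_toeplitz_compression :
    ∃ ρ : Toeplitz n →+*
        (lp (fun _ : Transverse S => ℂ) 2 →L[ℂ] lp (fun _ : Transverse S => ℂ) 2),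
      ∀ (S' : Finset (Fin n)) (Q : Toeplitz n), IsQProj S' Q.1 → ∀ w : Transverse S,
        ((S ⊆ S' ∧ ∀ i ∉ S', w.1 i = 0) → ρ Q (lp.single 2 w 1) = lp.single 2 w 1) ∧
        (¬(S ⊆ S' ∧ ∀ i ∉ S', w.1 i = 0) → ρ Q (lp.single 2 w 1) = 0) := by
  obtain ⟨ρ, hρ⟩ := exists_asymptotic_compression ((Toeplitz n).subtype : Toeplitz n →+* _)
    (boxIsometry S) fun T => exists_mem_asymptoticIntertwiners_of_mem_toeplitz S T.2
  refine ⟨ρ, fun S' Q hQ w => ?_⟩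
  have key : ∀ y, (∀ k, Q.1 (boxVector S k w.1) = boxIsometry S k y) →
      ρ Q (lp.single 2 w 1) = y := by
    intro y hy
    have h := (mem_asymptoticIntertwiners.1 (hρ Q) (lp.single 2 w 1)).norm
    have h' : Tendsto (fun _ : ℕ => ‖y - ρ Q (lp.single 2 w 1)‖) atTop (𝓝 ‖(0 : Hn n)‖) := by
      refine h.congr fun k => ?_
      change ‖Q.1 (boxIsometry S k (lp.single 2 w 1)) - _‖ = _
      rw [boxIsometry_single_one, hy k, ← map_sub, LinearIsometry.norm_map]
    have h0 := tendsto_nhds_unique tendsto_const_nhds h'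
    rw [norm_zero, norm_eq_zero, sub_eq_zero] at h0
    exact h0.symm
  classical
  refine ⟨fun hw => key _ fun k => ?_, fun hw => key _ fun k => ?_⟩
  · rw [hQ.apply_boxVector, if_pos hw, boxIsometry_single_one]
  · rw [hQ.apply_boxVector, if_neg hw, map_zero]

end Compression

section Ranks

theorem padMat_diagonal_apply {R ι : Type*} [Semiring R] [Fintype ι] [DecidableEq ι] {N : ℕ}
    (f : ι ↪ Fin N) (d : ι → R) (i j : Fin N) :
    padMat f (Matrix.diagonal d) i j = ∑ a, if f a = i ∧ f a = j then d a else 0 := by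
  refine Finset.sum_congr rfl fun a _ => ?_
  rw [Finset.sum_eq_single a]
  · rw [Matrix.diagonal_apply_eq]
  · intro b _ hb
    rw [Matrix.diagonal_apply_ne _ hb.symm, ite_self]
  · simp

variable {B M : Type*} [Ring B] [AddCommGroup M] [Module ℂ M]

/-- Matrices over `B` acting on column vectors with entries in a representation of `B`. -/
def matrixAction (N : ℕ) (σ : B →+* Module.End ℂ M) :
    Matrix (Fin N) (Fin N) B →+* Module.End ℂ (Fin N → M) :=
  (endVecRingEquivMatrixEnd (Fin N) ℂ M).symm.toRingHom.comp σ.mapMatrix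

theorem matrixAction_apply {N : ℕ} (σ : B →+* Module.End ℂ M) (P : Matrix (Fin N) (Fin N) B)
    (v : Fin N → M) (i : Fin N) : matrixAction N σ P v i = ∑ j, σ (P i j) (v j) := rfl

theorem matrixAction_padMat_diagonal_apply {ι : Type*} [Fintype ι] [DecidableEq ι] {N : ℕ}
    (σ : B →+* Module.End ℂ M) (f : ι ↪ Fin N) (d : ι → B) (v : Fin N → M) (i : Fin N) :
    matrixAction N σ (padMat f (Matrix.diagonal d)) v i =
      ∑ a, if f a = i then σ (d a) (v (f a)) else 0 := by
  simp only [matrixAction_apply, padMat_diagonal_apply, map_sum, LinearMap.sum_apply]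
  rw [Finset.sum_comm]
  refine Finset.sum_congr rfl fun a _ => ?_
  rw [Finset.sum_eq_single (f a)]
  · by_cases h : f a = i <;> simp [h]
  · intro j _ hj
    simp [hj.symm]
  · simp

/-- The range of a padded diagonal matrix is the product of the ranges of the diagonal entries. -/
theorem nonempty_range_padMat_diagonal_equiv {ι : Type*} [Fintype ι] [DecidableEq ι] {N : ℕ}
    (σ : B →+* Module.End ℂ M) (f : ι ↪ Fin N) (d : ι → B) :
    Nonempty ((∀ a, LinearMap.range (σ (d a))) ≃ₗ[ℂ]
      LinearMap.range (matrixAction N σ (padMat f (Matrix.diagonal d)))) := by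
  let W : (Fin N → M) →ₗ[ℂ] ∀ a, LinearMap.range (σ (d a)) :=
    LinearMap.pi fun a => (σ (d a)).rangeRestrict ∘ₗ LinearMap.proj (f a)
  let X : (∀ a, LinearMap.range (σ (d a))) →ₗ[ℂ] (Fin N → M) :=
    ∑ a, LinearMap.single ℂ (fun _ => M) (f a) ∘ₗ (LinearMap.range (σ (d a))).subtype ∘ₗ
      LinearMap.proj a
  have hXapply : ∀ u i, X u i = ∑ a, if f a = i then (u a : M) else 0 := by
    intro u i
    simp [X, LinearMap.sum_apply, Finset.sum_apply, Pi.single_apply, eq_comm]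
  have hX : Function.Injective X := by
    intro u u' h
    ext a
    have ha := congrFun h (f a)
    simpa [hXapply, f.injective.eq_iff] using ha
  have hW : LinearMap.range W = ⊤ := by
    rw [LinearMap.range_eq_top]
    intro u
    choose y hy using fun a => LinearMap.mem_range.1 (u a).2
    refine ⟨fun i => ∑ a, if f a = i then y a else 0, ?_⟩
    ext a
    simp [W, f.injective.eq_iff, hy]
  have hcomp : matrixAction N σ (padMat f (Matrix.diagonal d)) = X ∘ₗ W := by
    refine LinearMap.ext fun v => funext fun i => ?_
    rw [matrixAction_padMat_diagonal_apply, LinearMap.comp_apply, hXapply]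
    rfl
  rw [hcomp, LinearMap.range_comp_of_range_eq_top X hW]
  exact ⟨LinearEquiv.ofInjective X hX⟩

/-- Equivalent diagonal idempotents have isomorphic ranges in every representation. -/
theorem IdemEquiv.nonempty_range_equiv {ι κ : Type*} [Fintype ι] [Fintype κ] [DecidableEq ι]
    [DecidableEq κ] {d : ι → B} {d' : κ → B}
    (h : IdemEquiv (Matrix.diagonal d) (Matrix.diagonal d')) (σ : B →+* Module.End ℂ M) :
    Nonempty ((∀ a, LinearMap.range (σ (d a))) ≃ₗ[ℂ] ∀ b, LinearMap.range (σ (d' b))) := by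
  obtain ⟨N, f, g, U, hU⟩ := h
  obtain ⟨e⟩ := nonempty_range_padMat_diagonal_equiv σ f d
  obtain ⟨e'⟩ := nonempty_range_padMat_diagonal_equiv σ g d'
  set u := matrixAction N σ U.val
  set u' := matrixAction N σ (U⁻¹).val
  have hu'u : u' * u = 1 := by rw [← map_mul, Units.inv_mul, map_one]
  have hinj : Function.Injective u :=
    Function.LeftInverse.injective (g := u') fun x => DFunLike.congr_fun hu'u x
  have hsurj : LinearMap.range u' = ⊤ :=
    LinearMap.range_eq_top.2
      (Function.RightInverse.surjective fun x => DFunLike.congr_fun hu'u x)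
  have hrange : LinearMap.range (matrixAction N σ (padMat g (Matrix.diagonal d'))) =
      (LinearMap.range (matrixAction N σ (padMat f (Matrix.diagonal d)))).map u := by
    rw [← hU, map_mul, map_mul, Module.End.mul_eq_comp, Module.End.mul_eq_comp,
      LinearMap.range_comp_of_range_eq_top _ hsurj, LinearMap.range_comp]
  exact ⟨e.trans ((Submodule.equivMapOfInjective u hinj _).trans
    ((LinearEquiv.ofEq _ _ hrange.symm).trans e'.symm))⟩

variable {J : Type*} [DecidableEq J] {E : lp (fun _ : J => ℂ) 2 →L[ℂ] lp (fun _ : J => ℂ) 2}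

theorem finrank_range_eq_one_of_single_one {w₀ : J} (h₀ : E (lp.single 2 w₀ 1) = lp.single 2 w₀ 1)
    (h : ∀ w ≠ w₀, E (lp.single 2 w 1) = 0) :
    Module.finrank ℂ (LinearMap.range E.toLinearMap) = 1 := by
  have hE : E = (innerSL ℂ (lp.single 2 w₀ (1 : ℂ) : lp (fun _ : J => ℂ) 2)).smulRight
      (lp.single 2 w₀ (1 : ℂ) : lp (fun _ : J => ℂ) 2) := by
    refine lp.continuousLinearMap_ext_single_one fun w => ?_
    rw [ContinuousLinearMap.smulRight_apply, innerSL_apply_apply, lp.inner_single_one_left,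
      lp.single_apply, Pi.single_apply]
    split_ifs with hw
    · rw [← hw, h₀, one_smul]
    · rw [h w (Ne.symm hw), zero_smul]
  have hne : (lp.single 2 w₀ (1 : ℂ) : lp (fun _ : J => ℂ) 2) ≠ 0 :=
    lp.orthonormal_single_one.ne_zero w₀
  have hrange : LinearMap.range E.toLinearMap =
      Submodule.span ℂ {(lp.single 2 w₀ (1 : ℂ) : lp (fun _ : J => ℂ) 2)} := by
    apply le_antisymm
    · rintro _ ⟨x, rfl⟩
      rw [hE]
      exact Submodule.smul_mem _ _ (Submodule.mem_span_singleton_self _)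
    · rw [Submodule.span_singleton_le_iff_mem]
      exact ⟨_, h₀⟩
  rw [hrange, finrank_span_singleton hne]

theorem not_finite_range_of_single_one {ι : Type*} [Infinite ι] {φ : ι → J}
    (hφ : Function.Injective φ) (h : ∀ a, E (lp.single 2 (φ a) 1) = lp.single 2 (φ a) 1) :
    ¬ Module.Finite ℂ (LinearMap.range E.toLinearMap) := by
  intro hfin
  let v : ι → LinearMap.range E.toLinearMap :=
    fun a => ⟨lp.single 2 (φ a) 1, _, h a⟩
  have hv : LinearIndependent ℂ v :=
    LinearIndependent.of_comp (Submodule.subtype _)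
      (lp.orthonormal_single_one.linearIndependent.comp φ hφ)
  have := hv.finite
  exact not_finite ι

end Ranks

section Main

variable {n : ℕ}

/-- The multiplicities of an antichain are recovered as the dimensions of the ranges of the
associated projections in suitable representations. -/
theorem finrank_range_antichain (S : Finset (Fin n)) {A : Finset (Finset (Fin n))}
    (hA : IsAntichain (· ⊆ ·) (A : Set (Finset (Fin n)))) (l : Finset (Fin n) → ℕ)
    {q : Finset (Fin n) → Toeplitz n}
    {ρ : Toeplitz n →+*
      (lp (fun _ : Transverse S => ℂ) 2 →L[ℂ] lp (fun _ : Transverse S => ℂ) 2)}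
    (hρ : ∀ (S' : Finset (Fin n)) (w : Transverse S),
      ((S ⊆ S' ∧ ∀ i ∉ S', w.1 i = 0) → ρ (q S') (lp.single 2 w 1) = lp.single 2 w 1) ∧
      (¬(S ⊆ S' ∧ ∀ i ∉ S', w.1 i = 0) → ρ (q S') (lp.single 2 w 1) = 0)) :
    Module.finrank ℂ (∀ p : (S' : {x // x ∈ A}) × Fin (l S'.1),
      LinearMap.range (ρ (q p.1.1)).toLinearMap) = if S ∈ A then l S else 0 := by
  have hself : Module.finrank ℂ (LinearMap.range (ρ (q S)).toLinearMap) = 1 := by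
    refine finrank_range_eq_one_of_single_one (w₀ := ⟨0, fun _ _ => rfl⟩)
      ((hρ S _).1 ⟨Finset.Subset.refl S, fun _ _ => rfl⟩) fun w hw => (hρ S w).2 fun h => hw ?_
    refine Subtype.ext (funext fun i => ?_)
    by_cases hi : i ∈ S
    · exact w.2 i hi
    · exact h.2 i hi
  have hnot : ∀ S', ¬ S ⊆ S' → ρ (q S') = 0 := fun S' hS' =>
    lp.continuousLinearMap_ext_single_one fun w => (hρ S' w).2 fun h => hS' h.1
  have hinf : ∀ S', S ⊂ S' → ¬ Module.Finite ℂ (LinearMap.range (ρ (q S')).toLinearMap) := by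
    intro S' hS'
    obtain ⟨i, hi', hi⟩ := Finset.exists_of_ssubset hS'
    have hsingle : ∀ (m : ℕ) (j : Fin n), j ≠ i → (Pi.single i m : Fin n → ℕ) j = 0 :=
      fun m j hj => Pi.single_eq_of_ne (M := fun _ => ℕ) hj m
    refine not_finite_range_of_single_one (ι := ℕ)
      (φ := fun m => ⟨Pi.single i m, fun j hj => hsingle m j fun h => hi (h ▸ hj)⟩) ?_ fun m => ?_
    · intro m m' h
      exact Pi.single_injective i (congrArg Subtype.val h)
    · exact (hρ S' _).1 ⟨hS'.1, fun j hj => hsingle m j fun h => hj (h ▸ hi')⟩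
  have hzero : ∀ S', ¬ S ⊆ S' →
      Module.finrank ℂ (LinearMap.range (ρ (q S')).toLinearMap) = 0 := by
    intro S' hS'
    rw [hnot S' hS', ContinuousLinearMap.toLinearMap_zero, LinearMap.range_zero, finrank_bot]
  by_cases hfin : ∀ p : (S' : {x // x ∈ A}) × Fin (l S'.1),
      Module.Finite ℂ (LinearMap.range (ρ (q p.1.1)).toLinearMap)
  · have hrank : ∀ p : (S' : {x // x ∈ A}) × Fin (l S'.1),
        Module.finrank ℂ (LinearMap.range (ρ (q p.1.1)).toLinearMap) =
          if p.1.1 = S then 1 else 0 := by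
      intro p
      split_ifs with h
      · rw [h, hself]
      · refine hzero _ fun hsub => hinf _ ⟨hsub, fun hsub' => h ?_⟩ (hfin p)
        exact Finset.Subset.antisymm hsub' hsub
    calc _ = ∑ T : {x // x ∈ A}, ∑ _j : Fin (l T.1), if T.1 = S then 1 else 0 := by
          rw [Module.finrank_pi_fintype, Fintype.sum_sigma]
          exact Finset.sum_congr rfl fun T _ => Finset.sum_congr rfl fun j _ => hrank ⟨T, j⟩
      _ = ∑ T : {x // x ∈ A}, if T.1 = S then l T.1 else 0 :=
          Finset.sum_congr rfl fun T _ => by by_cases h : T.1 = S <;> simp [h]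
      _ = if S ∈ A then l S else 0 := by
          rw [Finset.univ_eq_attach, Finset.sum_attach A fun T => if T = S then l T else 0,
            Finset.sum_ite_eq']
  · push Not at hfin
    obtain ⟨p, hp⟩ := hfin
    have hsub : S ⊆ p.1.1 := by
      by_contra hsub
      rw [hnot _ hsub] at hp
      refine hp ?_
      rw [ContinuousLinearMap.toLinearMap_zero, LinearMap.range_zero]
      infer_instance
    have hne : S ≠ p.1.1 := by
      intro h
      rw [← h] at hp
      exact hp (Module.finite_of_finrank_pos (by rw [hself]; exact one_pos))
    rw [if_neg fun hS : S ∈ A => hA hS p.1.2 hne hsub]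
    refine Module.finrank_of_not_finite fun hpi => hp ?_
    exact Module.Finite.of_surjective
      (LinearMap.proj (R := ℂ) (φ := fun p : (S' : {x // x ∈ A}) × Fin (l S'.1) =>
        LinearMap.range (ρ (q p.1.1)).toLinearMap) p) (LinearMap.proj_surjective p)

theorem IdemEquiv.refl {R ι : Type*} [Ring R] [Fintype ι] (P : Matrix ι ι R) : IdemEquiv P P :=
  ⟨Fintype.card ι, (Fintype.equivFin ι).toEmbedding, (Fintype.equivFin ι).toEmbedding, 1, by simp⟩

theorem idemEquiv_diagonal_sigma_of_eq {R α : Type*} [Ring R] [Fintype α] [DecidableEq α]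
    {m m' : α → ℕ} (h : m = m') (q : α → R) :
    IdemEquiv (Matrix.diagonal fun p : (a : α) × Fin (m a) => q p.1)
      (Matrix.diagonal fun p : (a : α) × Fin (m' a) => q p.1) := by
  subst h
  exact IdemEquiv.refl _

end Main

theorem stmt1 (n : ℕ) (hn : 1 ≤ n)
    (A A' : Finset (Finset (Fin n)))
    (hA : IsAntichain (· ⊆ ·) (A : Set (Finset (Fin n))))
    (hA' : IsAntichain (· ⊆ ·) (A' : Set (Finset (Fin n))))
    (l l' : Finset (Fin n) → ℕ)
    (hl : ∀ S ∈ A, 1 ≤ l S) (hl' : ∀ S ∈ A', 1 ≤ l' S)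
    (Q : Finset (Fin n) → (Hn n →L[ℂ] Hn n))
    (hQ : ∀ S, IsQProj S (Q S)) (hmem : ∀ S, Q S ∈ Toeplitz n) :
    IdemEquiv (antichainMat A l fun S => (⟨Q S, hmem S⟩ : Toeplitz n))
        (antichainMat A' l' fun S => (⟨Q S, hmem S⟩ : Toeplitz n)) ↔
      A = A' ∧ ∀ S ∈ A, l S = l' S := by
  constructor
  · intro h
    have key : ∀ S, (if S ∈ A then l S else 0) = if S ∈ A' then l' S else 0 := by
      intro S
      obtain ⟨ρ, hρ⟩ := exists_toeplitz_compression S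
      obtain ⟨e⟩ := IdemEquiv.nonempty_range_equiv h
        (ContinuousLinearMap.toLinearMapRingHom.comp ρ)
      rw [← finrank_range_antichain S hA l (q := fun S => ⟨Q S, hmem S⟩)
          fun S' => hρ S' _ (hQ S'),
        ← finrank_range_antichain S hA' l' (q := fun S => ⟨Q S, hmem S⟩)
          fun S' => hρ S' _ (hQ S')]
      exact e.finrank_eq
    have hAA' : A = A' := by
      ext S
      have hS := key S
      constructor
      · intro hSA
        by_contra hSA'
        rw [if_pos hSA, if_neg hSA'] at hS
        exact absurd (hl S hSA) (by omega)
      · intro hSA'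
        by_contra hSA
        rw [if_neg hSA, if_pos hSA'] at hS
        exact absurd (hl' S hSA') (by omega)
    refine ⟨hAA', fun S hS => ?_⟩
    have hkey := key S
    rwa [if_pos hS, if_pos (hAA' ▸ hS)] at hkey
  · rintro ⟨rfl, hll'⟩
    exact idemEquiv_diagonal_sigma_of_eq (m := fun S : {x // x ∈ A} => l S.1)
      (m' := fun S : {x // x ∈ A} => l' S.1) (funext fun S => hll' S.1 S.2)
      fun S => (⟨Q S.1, hmem S.1⟩ : Toeplitz n)
end
end

section
/- Let n ≥ 1 and let (S_i)_{i∈I} be a nonempty finite family of subsets of Fin n. Let M be the set of maximal elements of {S_i : i ∈ I} under inclusion, and for S ∈ M set m(S) := #{i ∈ I : S_i = S}. Then the projection ⊞_{i∈I} Q_{S_i} over the Toeplitz algebra T_n is equivalent to the reduced ⊞-sum ⊞_{S∈M} ⊞^{m(S)} Q_S. -/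
noncomputable section

/-- `δ_z` is supported on `{z : z_i = 0 for all i ∉ S}`, the index set of the range of `Q_S`. -/
def SupportedOn {n : ℕ} (S : Finset (Fin n)) (z : Fin n → ℕ) : Prop := ∀ i ∉ S, z i = 0

theorem SupportedOn.mono {n : ℕ} {S T : Finset (Fin n)} {z : Fin n → ℕ} (h : S ⊆ T)
    (hz : SupportedOn S z) : SupportedOn T z :=
  fun i hi => hz i fun hS => hi (h hS)

theorem supportedOn_update_iff {n : ℕ} {S : Finset (Fin n)} {i : Fin n} (hi : i ∈ S)
    (z : Fin n → ℕ) (c : ℕ) : SupportedOn S (Function.update z i c) ↔ SupportedOn S z := by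
  refine forall₂_congr fun k hk => ?_
  rw [Function.update_of_ne (by rintro rfl; exact hk hi)]

theorem supportedOn_iff_insert {n : ℕ} {S : Finset (Fin n)} {i : Fin n} (hi : i ∉ S)
    (z : Fin n → ℕ) : SupportedOn S z ↔ SupportedOn (insert i S) z ∧ z i = 0 := by
  refine ⟨fun h => ⟨h.mono (Finset.subset_insert i S), h i hi⟩, fun h k hk => ?_⟩
  by_cases hki : k = i
  · rw [hki, h.2]
  · exact h.1 k (by simp [hki, hk])

theorem delta_ext {n : ℕ} {A B : Hn n →L[ℂ] Hn n} (h : ∀ z, A (delta z) = B (delta z)) :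
    A = B := by
  refine lp.ext_continuousLinearMap (by simp) fun z => ?_
  exact ContinuousLinearMap.ext_ring (h z)

theorem orthonormal_delta (n : ℕ) : Orthonormal ℂ (delta : (Fin n → ℕ) → Hn n) := by
  classical
  rw [orthonormal_iff_ite]
  intro z w
  simp [delta, lp.inner_single_left, Pi.single_apply]

theorem exists_isShift {n : ℕ} (i : Fin n) : ∃ T : Hn n →L[ℂ] Hn n, IsShift i T := by
  have hinj : Function.Injective fun z : Fin n → ℕ => Function.update z i (z i + 1) := by
    intro z w h
    funext k
    have hk := congrFun h k
    by_cases hki : k = i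
    · subst hki
      simpa using hk
    · simpa [hki] using hk
  have hv := (orthonormal_delta n).comp _ hinj
  refine ⟨hv.orthogonalFamily.linearIsometry.toContinuousLinearMap, fun z => ?_⟩
  simp [delta]

theorem IsShift.mem_toeplitz {n : ℕ} {i : Fin n} {T : Hn n →L[ℂ] Hn n} (hT : IsShift i T) :
    T ∈ Toeplitz n :=
  StarSubalgebra.le_topologicalClosure _ (StarAlgebra.subset_adjoin ℂ _ ⟨i, hT⟩)

theorem IsShift.star_apply_delta {n : ℕ} {i : Fin n} {T : Hn n →L[ℂ] Hn n} (hT : IsShift i T)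
    (z : Fin n → ℕ) :
    star T (delta z) = if z i = 0 then 0 else delta (Function.update z i (z i - 1)) := by
  classical
  refine lp.ext (funext fun w => ?_)
  have hw : ∀ x : Hn n, x w = inner ℂ (delta w) x := fun x => by
    simp [delta, lp.inner_single_left]
  rw [hw, hw, ContinuousLinearMap.star_eq_adjoint, ContinuousLinearMap.adjoint_inner_right, hT w,
    orthonormal_iff_ite.mp (orthonormal_delta n)]
  split_ifs with h h0 h0
  · subst h
    simp at h0
  · rw [← h]
    simp [(orthonormal_delta n).1 w]
  · simp
  · rw [orthonormal_iff_ite.mp (orthonormal_delta n), if_neg]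
    rintro rfl
    apply h
    simp [Nat.sub_add_cancel (Nat.pos_of_ne_zero h0)]

/-- For `S ⊂ T` the algebra `T_n` contains an isometry with range projection `1 - Q_S` that commutes
with `Q_T`. -/
theorem exists_isometry_of_ssubset {n : ℕ} {S T : Finset (Fin n)} (hST : S ⊂ T)
    (Q : Finset (Fin n) → (Hn n →L[ℂ] Hn n)) (hQ : ∀ S, IsQProj S (Q S))
    (hmem : ∀ S, Q S ∈ Toeplitz n) :
    ∃ w v : Toeplitz n, v * w = 1 ∧ w * v = 1 - ⟨Q S, hmem S⟩ ∧
      ⟨Q T, hmem T⟩ * w = w * ⟨Q T, hmem T⟩ ∧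
      (⟨Q T, hmem T⟩ * ⟨Q S, hmem S⟩ : Toeplitz n) = ⟨Q S, hmem S⟩ := by
  classical
  have hsub := hST.1
  obtain ⟨i, hiT, hiS⟩ := Finset.exists_of_ssubset hST
  have hins : insert i S ⊆ T := Finset.insert_subset hiT hsub
  obtain ⟨s, hs⟩ := exists_isShift i
  have hQ' : ∀ S z, Q S (delta z) = if SupportedOn S z then delta z else 0 := fun S z => by
    rw [hQ S z]
    exact if_congr Iff.rfl rfl rfl
  set q := Q (insert i S) with hq
  let w : Toeplitz n := ⟨s, hs.mem_toeplitz⟩ * ⟨q, hmem _⟩ + (1 - ⟨q, hmem _⟩)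
  let v : Toeplitz n := star ⟨s, hs.mem_toeplitz⟩ * ⟨q, hmem _⟩ + (1 - ⟨q, hmem _⟩)
  have hw : ∀ z, (w : Hn n →L[ℂ] Hn n) (delta z) = if SupportedOn (insert i S) z then
      delta (Function.update z i (z i + 1)) else delta z := fun z => by
    by_cases hz : SupportedOn (insert i S) z <;> simp [w, hq, hQ', hz, hs z]
  have hv : ∀ z, (v : Hn n →L[ℂ] Hn n) (delta z) = if SupportedOn (insert i S) z then
      (if z i = 0 then 0 else delta (Function.update z i (z i - 1))) else delta z := fun z => by
    by_cases hz : SupportedOn (insert i S) z <;>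
      simp [v, hq, hQ', hz, hs.star_apply_delta z]
  have hupd := supportedOn_update_iff (Finset.mem_insert_self i S)
  refine ⟨w, v, Subtype.ext (delta_ext fun z => ?_), Subtype.ext (delta_ext fun z => ?_),
    Subtype.ext (delta_ext fun z => ?_), Subtype.ext (delta_ext fun z => ?_)⟩
  · by_cases hz : SupportedOn (insert i S) z <;> simp [hw, hv, hz, hupd]
  · by_cases hz : SupportedOn (insert i S) z
    · by_cases h0 : z i = 0
      · simp [hv, hz, h0, hQ', supportedOn_iff_insert hiS]
      · simp [hv, hw, hz, h0, hQ', hupd, supportedOn_iff_insert hiS,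
          Nat.sub_add_cancel (Nat.pos_of_ne_zero h0)]
    · simp [hv, hw, hz, hQ', supportedOn_iff_insert hiS]
  · by_cases hz : SupportedOn (insert i S) z
    · simp [hw, hz, hQ', supportedOn_update_iff hiT, hz.mono hins]
    · by_cases hzT : SupportedOn T z <;> simp [hw, hz, hQ', hzT]
  · by_cases hz : SupportedOn S z
    · simp [hQ', hz, hz.mono hsub]
    · simp [hQ', hz]

/-- A diagonal entry `e` is absorbed by an entry `f` if `f` commutes with an isometry whose
range has complement `e ≤ f`. -/
theorem isConj_diagonal_update_zero {R ι : Type*} [Ring R] [Fintype ι] [DecidableEq ι]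
    (d : ι → R) {i j : ι} (hij : i ≠ j) {w v : R} (hvw : v * w = 1) (hwv : w * v = 1 - d i)
    (hcomm : d j * w = w * d j) (hle : d j * d i = d i) :
    IsConj (Matrix.diagonal d) (Matrix.diagonal (Function.update d i 0)) := by
  have he : d i = 1 - w * v := by rw [hwv]; abel
  have hew : d i * w = 0 := by rw [he, sub_mul, mul_assoc, hvw]; simp
  have hve : v * d i = 0 := by rw [he, mul_sub, ← mul_assoc, hvw]; simp
  have hee : d i * d i = d i := by
    nth_rewrite 2 [he]
    rw [mul_sub, ← mul_assoc, hew]; simp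
  let a : ι → R := Function.update (Function.update 1 i v) j w
  let b : ι → R := Function.update (Function.update 1 i w) j v
  have hai : a i = v := by simp [a, hij]
  have haj : a j = w := by simp [a]
  have hbi : b i = w := by simp [b, hij]
  have hbj : b j = v := by simp [b]
  have ha : ∀ k, k ≠ i → k ≠ j → a k = 1 := fun k h h' => by simp [a, h, h']
  have hb : ∀ k, k ≠ i → k ≠ j → b k = 1 := fun k h h' => by simp [b, h, h']
  have hds : ∀ (c : ι → R) (k l : ι) (x : R),
      Matrix.diagonal c * Matrix.single k l x = Matrix.single k l (c k * x) := fun c k l x => by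
    ext k' l'
    simp only [Matrix.diagonal_mul, Matrix.single_apply]
    split_ifs with h <;> simp [h]
  have hsd : ∀ (c : ι → R) (k l : ι) (x : R),
      Matrix.single k l x * Matrix.diagonal c = Matrix.single k l (x * c l) := fun c k l x => by
    ext k' l'
    by_cases hk : k = k' <;> by_cases hl : l = l' <;> simp [hk, hl]
  let U : (Matrix ι ι R)ˣ :=
    { val := Matrix.diagonal a + Matrix.single j i (d i)
      inv := Matrix.diagonal b + Matrix.single i j (d i)
      val_inv := by
        simp only [add_mul, mul_add, Matrix.diagonal_mul_diagonal, hds, hsd,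
          Matrix.single_mul_single_same, hai, hbi, hve, hew, hee, Matrix.single_zero, add_zero,
          zero_add, ← Matrix.diagonal_single, Matrix.diagonal_add]
        rw [Matrix.diagonal_eq_one]
        funext k
        by_cases hki : k = i
        · subst hki
          simp [hai, hbi, hvw, hij]
        by_cases hkj : k = j
        · subst hkj
          simp [haj, hbj, hwv]
        · simp [ha k hki hkj, hb k hki hkj, hkj]
      inv_val := by
        simp only [add_mul, mul_add, Matrix.diagonal_mul_diagonal, hds, hsd,
          Matrix.single_mul_single_same, haj, hbj, hve, hew, hee, Matrix.single_zero, add_zero,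
          zero_add, ← Matrix.diagonal_single, Matrix.diagonal_add]
        rw [Matrix.diagonal_eq_one]
        funext k
        by_cases hki : k = i
        · subst hki
          simp [hai, hbi, hwv]
        by_cases hkj : k = j
        · subst hkj
          simp [haj, hbj, hvw, hki]
        · simp [ha k hki hkj, hb k hki hkj, hki] }
  refine ⟨U, ?_⟩
  change (Matrix.diagonal a + Matrix.single j i (d i)) * Matrix.diagonal d =
    Matrix.diagonal (Function.update d i 0) * (Matrix.diagonal a + Matrix.single j i (d i))
  simp only [add_mul, mul_add, Matrix.diagonal_mul_diagonal, hds, hsd, hee,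
    Function.update_of_ne hij.symm, hle]
  congr 2
  funext k
  by_cases hki : k = i
  · subst hki
    simp [hai, hve]
  by_cases hkj : k = j
  · subst hkj
    simp [haj, hcomm, hki]
  · simp [ha k hki hkj, hki]

/-- Diagonal entries outside a set of indices `p` can be replaced by `0` if each of them is
absorbed by an entry indexed by `p`. -/
theorem isConj_diagonal_ite {R ι : Type*} [Ring R] [Fintype ι] [DecidableEq ι] (d : ι → R)
    (p : ι → Prop) [DecidablePred p]
    (hp : ∀ i, ¬ p i → ∃ j, p j ∧ ∃ w v, v * w = 1 ∧ w * v = 1 - d i ∧ d j * w = w * d j ∧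
      d j * d i = d i) :
    IsConj (Matrix.diagonal d) (Matrix.diagonal fun i => if p i then d i else 0) := by
  suffices h : ∀ K : Finset ι, (∀ i ∈ K, ¬ p i) →
      IsConj (Matrix.diagonal d) (Matrix.diagonal fun i => if i ∈ K then 0 else d i) by
    convert h (Finset.univ.filter fun i => ¬ p i) (by simp) using 3 with i
    by_cases hi : p i <;> simp [hi]
  intro K
  induction K using Finset.induction_on with
  | empty => intro _; simpa using IsConj.refl _
  | insert i K hiK ih =>
    intro hK
    refine (ih fun k hk => hK k (Finset.mem_insert_of_mem hk)).trans ?_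
    have hi := hK i (Finset.mem_insert_self i K)
    obtain ⟨j, hj, w, v, hvw, hwv, hcomm, hle⟩ := hp i hi
    have hjK : j ∉ K := fun h => hK j (Finset.mem_insert_of_mem h) hj
    convert isConj_diagonal_update_zero (fun k => if k ∈ K then 0 else d k)
      (i := i) (j := j) (by rintro rfl; exact hi hj) hvw
      (by simpa [hiK] using hwv) (by simpa [hjK] using hcomm) (by simpa [hiK, hjK] using hle)
      using 2
    funext k
    by_cases hki : k = i <;> simp [hki]

theorem padMat_diagonal {R ι : Type*} [Semiring R] [Fintype ι] [DecidableEq ι] {N : ℕ}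
    (f : ι ↪ Fin N) (d : ι → R) (c : Fin N → R) (hc : ∀ a, c (f a) = d a)
    (hc' : ∀ k, (∀ a, f a ≠ k) → c k = 0) :
    padMat f (Matrix.diagonal d) = Matrix.diagonal c := by
  classical
  ext k l
  simp only [padMat, Matrix.diagonal_apply]
  by_cases hk : ∃ a, f a = k
  · obtain ⟨a, rfl⟩ := hk
    rw [Finset.sum_eq_single a, Finset.sum_eq_single a]
    · simp [hc]
    · intro b _ hb
      simp [hb.symm]
    · simp
    · intro b _ hb
      simp [hb]
    · simp
  · push Not at hk
    simp [hk, hc' k hk]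

theorem stmt2 (n : ℕ) (hn : 1 ≤ n)
    (I : Type) [Fintype I] [DecidableEq I] [Nonempty I]
    (Sfam : I → Finset (Fin n))
    (M : Finset (Finset (Fin n)))
    (hM : ∀ S, S ∈ M ↔ S ∈ Finset.image Sfam Finset.univ ∧
        ∀ T ∈ Finset.image Sfam Finset.univ, S ⊆ T → S = T)
    (m : Finset (Fin n) → ℕ)
    (hm : ∀ S, m S = (Finset.univ.filter fun i => Sfam i = S).card)
    (Q : Finset (Fin n) → (Hn n →L[ℂ] Hn n))
    (hQ : ∀ S, IsQProj S (Q S)) (hmem : ∀ S, Q S ∈ Toeplitz n) :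
    IdemEquiv (Matrix.diagonal fun i : I => (⟨Q (Sfam i), hmem (Sfam i)⟩ : Toeplitz n))
      (antichainMat M m fun S => (⟨Q S, hmem S⟩ : Toeplitz n)) := by
  classical
  let c : I ≃ Fin (Fintype.card I) := Fintype.equivFin I
  have hcard : ∀ S, Fintype.card {i // Sfam i = S} = m S := fun S => by
    rw [hm S, Fintype.card_subtype]
  let φ : ∀ S, {i // Sfam i = S} ≃ Fin (m S) := fun S => Fintype.equivFinOfCardEq (hcard S)
  let g : ((S : {x // x ∈ M}) × Fin (m S.1)) → I := fun p => ((φ p.1.1).symm p.2).1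
  have hg : ∀ p, Sfam (g p) = p.1.1 := fun p => ((φ p.1.1).symm p.2).2
  have hginj : Function.Injective g := by
    rintro ⟨⟨S, hS⟩, k⟩ ⟨⟨T, hT⟩, l⟩ h
    obtain rfl : S = T := by
      have := congrArg Sfam h
      rwa [hg, hg] at this
    simpa [g, Subtype.coe_inj] using h
  have hgsurj : ∀ i, Sfam i ∈ M → ∃ p, g p = i := fun i hi =>
    ⟨⟨⟨Sfam i, hi⟩, φ (Sfam i) ⟨i, rfl⟩⟩, by simp [g]⟩
  have hmax : ∀ i, Sfam i ∉ M → ∃ j, Sfam j ∈ M ∧ Sfam i ⊂ Sfam j := by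
    intro i hi
    obtain ⟨T, hiT, hT⟩ := (Finset.univ.image Sfam).exists_le_maximal
      (Finset.mem_image_of_mem Sfam (Finset.mem_univ i))
    obtain ⟨j, -, rfl⟩ := Finset.mem_image.mp hT.1
    have hj : Sfam j ∈ M := (hM _).mpr ⟨hT.1, fun T hT' h => hT.eq_of_le hT' h⟩
    exact ⟨j, hj, lt_of_le_of_ne hiT fun h => hi (h ▸ hj)⟩
  obtain ⟨U, hU⟩ := isConj_diagonal_ite
    (fun k => (⟨Q (Sfam (c.symm k)), hmem (Sfam (c.symm k))⟩ : Toeplitz n))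
    (fun k => Sfam (c.symm k) ∈ M) fun k hk => by
      obtain ⟨j, hj, hlt⟩ := hmax _ hk
      rw [← c.symm_apply_apply j] at hj hlt
      exact ⟨c j, hj, exists_isometry_of_ssubset hlt Q hQ hmem⟩
  refine ⟨_, c.toEmbedding, ⟨c ∘ g, c.injective.comp hginj⟩, U, ?_⟩
  rw [padMat_diagonal c.toEmbedding _
      (fun k => (⟨Q (Sfam (c.symm k)), hmem (Sfam (c.symm k))⟩ : Toeplitz n)) (by simp)
      (fun k hk => absurd (c.apply_symm_apply k) (hk _)),
    antichainMat, padMat_diagonal _ _ (fun k => if Sfam (c.symm k) ∈ M then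
      (⟨Q (Sfam (c.symm k)), hmem (Sfam (c.symm k))⟩ : Toeplitz n) else 0)]
  · rw [Units.mul_inv_eq_iff_eq_mul]
    exact hU
  · intro p
    simp [hg]
  · intro k hk
    refine if_neg fun h => ?_
    obtain ⟨p, hp⟩ := hgsurj _ h
    exact hk p (by simp [hp])
end
end
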